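/- Let f be a nonconstant polynomial with integer coefficients, let ρ be an irrational real number, and let J ⊆ (0,1) be a finite union of intervals. Then the set H = {n ∈ ℕ : frac(ρ·f(n)) ∈ J} has an asymptotic density, and d(H) = μ(J). -/

import Mathlib

open Filter

noncomputable def wAvg (u : ℕ → ℂ) (N : ℕ) : ℂ := (∑ n ∈ Finset.range N, u n) / N

lemma wAvg_shift_one (u : ℕ → ℂ) (hu : ∀ n, ‖u n‖ ≤ 1) (a : ℂ)
    (h : Tendsto (wAvg u) atTop (nhds a)) : Tendsto (wAvg (fun n => u (n + 1))) atTop (nhds a) := by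
  have h2 : Tendsto (fun N : ℕ => (u N - u 0) / (N : ℂ)) atTop (nhds 0) := by
    apply squeeze_zero_norm (a := fun N : ℕ => 2 / (N : ℝ))
    · intro N
      rw [norm_div, Complex.norm_natCast]
      gcongr
      calc _ ≤ ‖u N‖ + ‖u 0‖ := norm_sub_le _ _
        _ ≤ 2 := by linarith [hu N, hu 0]
    · exact tendsto_const_div_atTop_nhds_zero_nat 2
  have := h.add h2
  rw [add_zero] at this
  refine this.congr fun N => ?_
  unfold wAvg
  rw [← add_div]
  congr 1
  have := Finset.sum_range_succ u N
  rw [Finset.sum_range_succ'] at this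
  linear_combination -this

lemma wAvg_shift (u : ℕ → ℂ) (hu : ∀ n, ‖u n‖ ≤ 1) (a : ℂ)
    (h : Tendsto (wAvg u) atTop (nhds a)) (k : ℕ) :
    Tendsto (wAvg (fun n => u (n + k))) atTop (nhds a) := by
  induction k with
  | zero => simpa using h
  | succ k ih =>
    have := wAvg_shift_one (fun n => u (n + k)) (fun n => hu _) a ih
    refine this.congr fun N => ?_
    unfold wAvg
    congr 1
    refine Finset.sum_congr rfl fun n _ => ?_
    simp only [add_assoc, add_comm 1 k]

lemma wAvg_sub (u v : ℕ → ℂ) (N : ℕ) : wAvg (fun n => u n - v n) N = wAvg u N - wAvg v N := by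
  simp [wAvg, Finset.sum_sub_distrib, sub_div]

lemma wAvg_sub_shift_one (u : ℕ → ℂ) (hu : ∀ n, ‖u n‖ ≤ 1) (k : ℕ) :
    Tendsto (fun N => wAvg (fun n => u (n + k)) N - wAvg u N) atTop (nhds 0) := by
  induction k with
  | zero => simp
  | succ k ih =>
    have h2 : Tendsto (fun N : ℕ => (u (N + k) - u (0 + k)) / (N : ℂ)) atTop (nhds 0) := by
      apply squeeze_zero_norm (a := fun N : ℕ => 2 / (N : ℝ))
      · intro N
        rw [norm_div, Complex.norm_natCast]
        gcongr
        calc _ ≤ ‖u (N + k)‖ + ‖u (0 + k)‖ := norm_sub_le _ _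
          _ ≤ 2 := by linarith [hu (N + k), hu (0 + k)]
      · exact tendsto_const_div_atTop_nhds_zero_nat 2
    have := ih.add h2
    rw [add_zero] at this
    refine this.congr fun N => ?_
    unfold wAvg
    rw [← sub_div, ← sub_div, ← add_div]
    congr 1
    have := Finset.sum_range_succ (fun n => u (n + k)) N
    rw [Finset.sum_range_succ'] at this
    have e : ∀ n, n + 1 + k = n + (k + 1) := fun n => by ring
    simp only [e] at this
    linear_combination -this

lemma wAvg_norm_sq (w : ℕ → ℂ) (N : ℕ) :
    ‖wAvg w N‖ ^ 2 ≤ ‖wAvg (fun n => w n * (starRingEnd ℂ) (w n)) N‖ := by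
  rcases Nat.eq_zero_or_pos N with rfl | hN
  · simp [wAvg]
  have hN' : (0 : ℝ) < N := by exact_mod_cast hN
  have e : ∑ n ∈ Finset.range N, w n * (starRingEnd ℂ) (w n)
      = ((∑ n ∈ Finset.range N, ‖w n‖ ^ 2 : ℝ) : ℂ) := by
    push_cast
    exact Finset.sum_congr rfl fun n _ => Complex.mul_conj' _
  unfold wAvg
  rw [e, norm_div, norm_div, Complex.norm_natCast, Complex.norm_real, Real.norm_of_nonneg
    (Finset.sum_nonneg fun _ _ => by positivity), div_pow, div_le_div_iff₀ (by positivity) hN']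
  have h1 : ‖∑ n ∈ Finset.range N, w n‖ ≤ ∑ n ∈ Finset.range N, ‖w n‖ := norm_sum_le _ _
  have h2 := sq_sum_le_card_mul_sum_sq (s := Finset.range N) (f := fun n => ‖w n‖)
  rw [Finset.card_range] at h2
  have h3 : ‖∑ n ∈ Finset.range N, w n‖ ^ 2 ≤ N * ∑ n ∈ Finset.range N, ‖w n‖ ^ 2 :=
    le_trans (by gcongr) h2
  nlinarith

lemma vdc (u : ℕ → ℂ) (hu : ∀ n, ‖u n‖ = 1)
    (h : ∀ k, 0 < k → Tendsto (wAvg (fun n => u (n + k) * (starRingEnd ℂ) (u n))) atTop (nhds 0)) :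
    Tendsto (wAvg u) atTop (nhds 0) := by
  have hcorr : ∀ i j : ℕ, Tendsto (wAvg (fun n => u (n + i) * (starRingEnd ℂ) (u (n + j)))) atTop
      (nhds (if i = j then 1 else 0)) := by
    intro i j
    rcases lt_trichotomy i j with hij | rfl | hij
    · rw [if_neg hij.ne]
      obtain ⟨k, rfl⟩ := Nat.exists_eq_add_of_lt hij
      have := wAvg_shift _ (by intro n; simp [hu]) _ (h (k + 1) (by omega)) i
      have := (Complex.continuous_conj.tendsto _).comp this
      rw [map_zero] at this
      refine this.congr fun N => ?_
      simp only [wAvg, Function.comp, map_div₀, map_sum, map_mul, Complex.conj_conj, map_natCast]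
      congr 1
      refine Finset.sum_congr rfl fun n _ => ?_
      rw [mul_comm, add_assoc n i (k+1), add_assoc i]
    · rw [if_pos rfl]
      refine tendsto_const_nhds.congr' ?_
      filter_upwards [eventually_gt_atTop 0] with N hN
      have : (N : ℂ) ≠ 0 := by exact_mod_cast hN.ne'
      simp [wAvg, Complex.mul_conj', hu, this]
    · rw [if_neg hij.ne']
      obtain ⟨k, rfl⟩ := Nat.exists_eq_add_of_lt hij
      have := wAvg_shift _ (by intro n; simp [hu]) _ (h (k + 1) (by omega)) j
      refine this.congr fun N => ?_
      simp only [wAvg]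
      congr 1
      refine Finset.sum_congr rfl fun n _ => ?_
      rw [add_assoc n j (k+1), add_assoc j]
  have hw : ∀ H : ℕ, 0 < H → ∀ w : ℕ → ℂ, (w = fun n => (∑ k ∈ Finset.range H, u (n + k)) / H) →
      Tendsto (fun N => wAvg w N - wAvg u N) atTop (nhds 0) ∧
      Tendsto (wAvg (fun n => w n * (starRingEnd ℂ) (w n))) atTop (nhds (1 / H)) := by
    intro H hH w hw
    have hH' : (H : ℂ) ≠ 0 := by exact_mod_cast hH.ne'
    constructor
    · have := (tendsto_finsetSum (Finset.range H)
        fun k _ => wAvg_sub_shift_one u (fun n => (hu n).le) k).div_const (H : ℂ)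
      simp only [Finset.sum_const_zero, zero_div] at this
      refine this.congr fun N => ?_
      simp only [hw, wAvg, Finset.sum_sub_distrib, Finset.sum_const, Finset.card_range,
        nsmul_eq_mul, sub_div, mul_div_cancel_left₀ _ hH']
      rw [← Finset.sum_div, ← Finset.sum_div, Finset.sum_comm, div_right_comm]
    · have := (tendsto_finsetSum (Finset.range H)
        fun i _ => tendsto_finsetSum (Finset.range H) fun j _ => hcorr i j).div_const
          ((H : ℂ) * H)
      have e : (∑ i ∈ Finset.range H, ∑ j ∈ Finset.range H, (if i = j then (1 : ℂ) else 0))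
        / ((H : ℂ) * H) = 1 / H := by
        have : ∀ i ∈ Finset.range H, (∑ j ∈ Finset.range H, (if i = j then (1 : ℂ) else 0)) = 1 := by
          intro i hi
          rw [Finset.sum_ite_eq, if_pos hi]
        rw [Finset.sum_congr rfl this]
        simp
      rw [e] at this
      refine this.congr fun N => ?_
      simp only [hw, wAvg, map_div₀, map_sum, map_natCast]
      rw [← Finset.sum_congr rfl fun i _ => Finset.sum_div _ _ _, ← Finset.sum_div, div_right_comm]
      congr 1
      rw [Finset.sum_congr rfl fun i _ => Finset.sum_comm, Finset.sum_comm, Finset.sum_div]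
      refine Finset.sum_congr rfl fun n _ => ?_
      rw [div_mul_div_comm, Finset.sum_mul_sum]
  rw [Metric.tendsto_nhds]
  intro ε hε
  obtain ⟨H, hH⟩ := exists_nat_gt (1 / (ε / 2) ^ 2)
  have hHpos : (0 : ℝ) < H := lt_trans (by positivity) hH
  have hH0 : 0 < H := by exact_mod_cast hHpos
  obtain ⟨h1, h2⟩ := hw H hH0 _ rfl
  have h3 := h2.norm
  have hlt : ‖(1 / H : ℂ)‖ < (ε / 2) ^ 2 := by
    rw [norm_div, norm_one, Complex.norm_natCast]
    rw [div_lt_iff₀ (by positivity)] at hH ⊢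
    linarith
  filter_upwards [h3.eventually_lt_const hlt,
    (Metric.tendsto_nhds.1 h1) (ε / 2) (by positivity)] with N hN1 hN2
  have h4 := (wAvg_norm_sq _ N).trans_lt hN1
  have h5 := lt_of_pow_lt_pow_left₀ 2 (by positivity) h4
  rw [dist_zero_right] at hN2 ⊢
  have := norm_sub_norm_le (wAvg u N) (wAvg (fun n => (∑ k ∈ Finset.range H, u (n + k)) / H) N)
  rw [norm_sub_rev] at this
  linarith

noncomputable def wE (x : ℝ) : ℂ := Complex.exp (2 * Real.pi * Complex.I * x)

lemma wE_norm (x : ℝ) : ‖wE x‖ = 1 := by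
  unfold wE
  rw [show 2 * (Real.pi : ℂ) * Complex.I * x = ((2 * Real.pi * x : ℝ) : ℂ) * Complex.I by
    push_cast; ring]
  exact Complex.norm_exp_ofReal_mul_I _

lemma wE_add (x y : ℝ) : wE (x + y) = wE x * wE y := by
  unfold wE
  rw [← Complex.exp_add]; congr 1; push_cast; ring

lemma wE_conj (x : ℝ) : (starRingEnd ℂ) (wE x) = wE (-x) := by
  unfold wE
  rw [← Complex.exp_conj]; congr 1; simp [Complex.conj_ofNat]

lemma wE_nat_mul (n : ℕ) (x : ℝ) : wE (n * x) = wE x ^ n := by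
  unfold wE
  rw [← Complex.exp_nat_mul]; congr 1; push_cast; ring

lemma wE_ne_one (x : ℝ) (hx : Irrational x) : wE x ≠ 1 := by
  unfold wE
  rw [Ne, Complex.exp_eq_one_iff]
  rintro ⟨n, hn⟩
  have : (x : ℂ) = n := by
    have h0 := Complex.two_pi_I_ne_zero
    apply mul_left_cancel₀ h0
    rw [hn]; ring
  exact hx.ne_int n (by exact_mod_cast this)

lemma wAvg_geom (z c : ℂ) (hz : ‖z‖ = 1) (h1 : z ≠ 1) :
    Tendsto (wAvg (fun n => c * z ^ n)) atTop (nhds 0) := by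
  apply squeeze_zero_norm (a := fun N : ℕ => (‖c‖ * (2 / ‖z - 1‖)) / (N : ℝ))
  · intro N
    unfold wAvg
    rw [← Finset.mul_sum, geom_sum_eq h1, norm_div, Complex.norm_natCast, norm_mul, norm_div]
    gcongr
    calc _ ≤ ‖z ^ N‖ + ‖(1 : ℂ)‖ := norm_sub_le _ _
      _ = 2 := by rw [norm_pow, hz]; norm_num
  · exact tendsto_const_div_atTop_nhds_zero_nat _

open Polynomial in
lemma diff_natDegree (f : ℤ[X]) (hf : 2 ≤ f.natDegree) (k : ℕ) (hk : 0 < k) :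
    0 < (taylor (k : ℤ) f - f).natDegree ∧ (taylor (k : ℤ) f - f).natDegree < f.natDegree := by
  have hpos : 0 < (taylor (k : ℤ) f - f).natDegree := by
    by_contra hcon
    obtain ⟨c, hc⟩ := natDegree_eq_zero.1 (Nat.eq_zero_of_not_pos hcon)
    have hs : ∀ x : ℤ, f.eval (x + k) = f.eval x + c := by
      intro x
      have := congrArg (eval x) hc
      rw [eval_C, eval_sub, taylor_eval] at this
      linarith
    have hn : ∀ n : ℕ, f.eval ((k : ℤ) * n) = f.eval 0 + c * n := by
      intro n
      induction n with
      | zero => simp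
      | succ n ih =>
        have := hs (k * n)
        push_cast
        rw [mul_add, mul_one, this, ih]; ring
    have heq : f.comp (C (k : ℤ) * X) = C c * X + C (f.eval 0) := by
      apply eq_of_infinite_eval_eq
      apply (Set.infinite_range_of_injective (Nat.cast_injective (R := ℤ))).mono
      rintro _ ⟨n, rfl⟩
      simp [hn n, add_comm]
    have hd := congrArg natDegree heq
    rw [natDegree_comp, natDegree_C_mul_X _ (by exact_mod_cast hk.ne')] at hd
    have := natDegree_linear_le (a := c) (b := f.eval 0)
    omega
  refine ⟨hpos, ?_⟩
  have hf0 : f ≠ 0 := by rintro rfl; simp at hf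
  have := degree_sub_lt_left (p := taylor (k : ℤ) f) (q := f) (degree_taylor _ _)
    ((taylor_eq_zero _ _).not.2 hf0) (leadingCoeff_taylor _ _)
  rw [degree_taylor] at this
  exact natDegree_lt_natDegree (by intro h; simp [h] at hpos) this

open Polynomial in
lemma weyl_sum (ρ : ℝ) (hρ : Irrational ρ) (d : ℕ) : ∀ f : ℤ[X], f.natDegree = d → 0 < d →
    Tendsto (wAvg (fun n => wE (ρ * ((f.eval (n : ℤ) : ℤ) : ℝ)))) atTop (nhds 0) := by
  induction d using Nat.strong_induction_on with
  | _ d ih =>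
    intro f hfd hd
    rcases Nat.lt_or_ge d 2 with h | h
    · have h1 : f.natDegree = 1 := by omega
      obtain ⟨a, ha, b, rfl⟩ := natDegree_eq_one.1 h1
      refine (wAvg_geom (wE (ρ * a)) (wE (ρ * b)) (wE_norm _)
        (wE_ne_one _ (hρ.mul_intCast ha))).congr fun N => ?_
      unfold wAvg
      congr 1
      refine Finset.sum_congr rfl fun n _ => ?_
      beta_reduce
      rw [← wE_nat_mul, ← wE_add]
      congr 1
      simp
      ring
    · apply vdc _ (fun n => wE_norm _)
      intro k hk
      obtain ⟨h1, h2⟩ := diff_natDegree f (by omega) k hk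
      refine (ih _ (by omega) (taylor (k : ℤ) f - f) rfl h1).congr fun N => ?_
      unfold wAvg
      congr 1
      refine Finset.sum_congr rfl fun n _ => ?_
      beta_reduce
      rw [wE_conj, ← wE_add, eval_sub, taylor_eval]
      congr 1
      push_cast
      ring

open MeasureTheory

lemma integral_fourier_haar (k : ℤ) :
    ∫ x : AddCircle (1 : ℝ), fourier k x ∂AddCircle.haarAddCircle = if k = 0 then 1 else 0 := by
  have h := congrFun (fourierCoeff_fourier (T := 1) k) 0
  simp only [fourierCoeff, neg_zero, fourier_zero, one_smul] at h
  rw [h, Pi.single_apply]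
  simp only [eq_comm]

/-- averages of continuous functions -/
lemma avg_continuous (x : ℕ → AddCircle (1 : ℝ))
    (h : ∀ k : ℤ, k ≠ 0 → Tendsto (wAvg (fun n => fourier k (x n))) atTop (nhds 0))
    (φ : C(AddCircle (1 : ℝ), ℂ)) :
    Tendsto (wAvg (fun n => φ (x n))) atTop
      (nhds (∫ y, φ y ∂AddCircle.haarAddCircle)) := by
  have hIntg : ∀ φ : C(AddCircle (1 : ℝ), ℂ), Integrable φ AddCircle.haarAddCircle := fun φ =>
    φ.continuous.integrable_of_hasCompactSupport (HasCompactSupport.of_compactSpace _)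
  have hspan : ∀ p ∈ Submodule.span ℂ (Set.range (@fourier (1 : ℝ))),
      Tendsto (wAvg (fun n => p (x n))) atTop (nhds (∫ y, p y ∂AddCircle.haarAddCircle)) := by
    intro p hp
    induction hp using Submodule.span_induction with
    | mem p hp =>
      obtain ⟨k, rfl⟩ := hp
      rw [integral_fourier_haar]
      split_ifs with hk
      · subst hk
        refine tendsto_const_nhds.congr' ?_
        filter_upwards [eventually_gt_atTop 0] with N hN
        have : (N : ℂ) ≠ 0 := by exact_mod_cast hN.ne'
        simp [wAvg, this]
      · exact h k hk
    | zero =>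
      have : wAvg (fun _ => 0) = fun _ => 0 := by ext N; simp [wAvg]
      simp [this]
    | add p q _ _ hp hq =>
      have := hp.add hq
      rw [← integral_add (hIntg p) (hIntg q)] at this
      refine this.congr fun N => ?_
      simp [wAvg, Finset.sum_add_distrib, add_div]
    | smul c p _ hp =>
      have := hp.const_mul c
      rw [← integral_const_mul] at this
      refine this.congr fun N => ?_
      simp [wAvg, ← Finset.mul_sum, mul_div_assoc]
  have hdense : φ ∈ (Submodule.span ℂ (Set.range (@fourier (1 : ℝ)))).topologicalClosure := by
    rw [span_fourier_closure_eq_top]; trivial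
  rw [← SetLike.mem_coe, Submodule.topologicalClosure_coe, Metric.mem_closure_iff] at hdense
  rw [Metric.tendsto_nhds]
  intro ε hε
  obtain ⟨p, hp, hpd⟩ := hdense (ε / 3) (by positivity)
  have hpt : ∀ y, ‖φ y - p y‖ ≤ ε / 3 := fun y => by
    rw [← dist_eq_norm]
    exact (ContinuousMap.dist_apply_le_dist y).trans hpd.le
  filter_upwards [(Metric.tendsto_nhds.1 (hspan p hp)) (ε / 3) (by positivity)] with N hN
  have h1 : ‖wAvg (fun n => φ (x n)) N - wAvg (fun n => p (x n)) N‖ ≤ ε / 3 := by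
    rw [← wAvg_sub]
    unfold wAvg
    rw [norm_div, Complex.norm_natCast]
    apply div_le_of_le_mul₀ (by positivity) (by positivity)
    refine (norm_sum_le _ _).trans ((Finset.sum_le_sum fun n _ => hpt (x n)).trans ?_)
    simp [mul_comm]
  have h2 : ‖(∫ y, φ y ∂AddCircle.haarAddCircle) - ∫ y, p y ∂AddCircle.haarAddCircle‖ ≤ ε / 3 := by
    rw [← integral_sub (hIntg φ) (hIntg p)]
    refine (norm_integral_le_of_norm_le_const (Eventually.of_forall hpt)).trans ?_
    simp
  rw [dist_eq_norm] at hN ⊢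
  set A := wAvg (fun n => φ (x n)) N
  set B := wAvg (fun n => p (x n)) N
  set S := ∫ y, φ y ∂AddCircle.haarAddCircle
  set T := ∫ y, p y ∂AddCircle.haarAddCircle
  calc ‖A - S‖ = ‖(A - B) + (B - T) - (S - T)‖ := by congr 1; ring
    _ ≤ ‖A - B‖ + ‖B - T‖ + ‖S - T‖ := (norm_sub_le _ _).trans (by gcongr; exact norm_add_le _ _)
    _ < ε := by linarith

noncomputable def empM (x : ℕ → AddCircle (1 : ℝ)) (N : ℕ) : Measure (AddCircle (1 : ℝ)) :=
  ((N + 1 : ℕ) : ENNReal)⁻¹ • ∑ n ∈ Finset.range (N + 1), Measure.dirac (x n)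

instance empM_prob (x : ℕ → AddCircle (1 : ℝ)) (N : ℕ) : IsProbabilityMeasure (empM x N) := by
  constructor
  simp only [empM, Measure.smul_apply, Measure.finsetSum_apply, measure_univ, Finset.sum_const,
    Finset.card_range, smul_eq_mul, nsmul_eq_mul, mul_one]
  exact ENNReal.inv_mul_cancel (by simp) (ENNReal.natCast_ne_top _)

lemma empM_integral (x : ℕ → AddCircle (1 : ℝ)) (N : ℕ) (φ : C(AddCircle (1 : ℝ), ℂ)) :
    ∫ y, φ y ∂(empM x N) = wAvg (fun n => φ (x n)) (N + 1) := by
  unfold empM wAvg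
  rw [integral_smul_measure, integral_finsetSum_measure]
  · simp only [integral_dirac]
    rw [ENNReal.toReal_inv, ENNReal.toReal_natCast, div_eq_inv_mul, Complex.real_smul]
    push_cast
    rfl
  · intro i _
    exact φ.continuous.integrable_of_hasCompactSupport (HasCompactSupport.of_compactSpace _)

open Classical in
lemma empM_apply (x : ℕ → AddCircle (1 : ℝ)) (N : ℕ) (E : Set (AddCircle (1 : ℝ))) :
    (empM x N E).toReal = ((Finset.range (N + 1)).filter (fun n => x n ∈ E)).card / ((N + 1 : ℕ) : ℝ) := by
  simp only [empM, Measure.smul_apply, Measure.finsetSum_apply, Measure.dirac_apply,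
    smul_eq_mul]
  rw [ENNReal.toReal_mul, ENNReal.toReal_inv, ENNReal.toReal_natCast, div_eq_inv_mul]
  congr 1
  simp [Set.indicator_apply]

open Classical in
lemma equidist (x : ℕ → AddCircle (1 : ℝ))
    (h : ∀ k : ℤ, k ≠ 0 → Tendsto (wAvg (fun n => fourier k (x n))) atTop (nhds 0))
    (E : Set (AddCircle (1 : ℝ)))
    (hfr : (AddCircle.haarAddCircle : Measure (AddCircle (1 : ℝ))) (frontier E) = 0) :
    Tendsto (fun N : ℕ => (((Finset.range N).filter (fun n => x n ∈ E)).card : ℝ) / (N : ℝ)) atTop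
      (nhds ((AddCircle.haarAddCircle : Measure (AddCircle (1 : ℝ))) E).toReal) := by
  let μs : ℕ → ProbabilityMeasure (AddCircle (1 : ℝ)) := fun N => ⟨empM x N, empM_prob x N⟩
  let μ : ProbabilityMeasure (AddCircle (1 : ℝ)) := ⟨AddCircle.haarAddCircle, inferInstance⟩
  have hlim : Tendsto μs atTop (nhds μ) := by
    rw [ProbabilityMeasure.tendsto_iff_forall_integral_rclike_tendsto ℂ]
    intro φ
    have := (tendsto_add_atTop_iff_nat 1).2 (avg_continuous x h φ.toContinuousMap)
    refine this.congr fun N => ?_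
    exact (empM_integral x N φ.toContinuousMap).symm
  have h1 := ProbabilityMeasure.tendsto_measure_of_null_frontier_of_tendsto' hlim (E := E) hfr
  have h2 := (ENNReal.tendsto_toReal (measure_ne_top _ E)).comp h1
  rw [← tendsto_add_atTop_iff_nat 1]
  exact h2.congr fun N => empM_apply x N E

lemma haar_apply (E : Set (AddCircle (1 : ℝ))) (hE : NullMeasurableSet E volume) :
    (AddCircle.haarAddCircle : Measure (AddCircle (1 : ℝ))) E
      = volume (((↑) : ℝ → AddCircle (1 : ℝ)) ⁻¹' E ∩ Set.Ioc 0 1) := by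
  have h1 : (AddCircle.haarAddCircle : Measure (AddCircle (1 : ℝ))) = volume := by
    rw [AddCircle.volume_eq_smul_haarAddCircle]; simp
  have h2 := (UnitAddCircle.measurePreserving_mk 0).measure_preimage hE
  rw [zero_add, Measure.restrict_apply' measurableSet_Ioc] at h2
  rw [h1]; exact h2.symm

lemma coe_inj_Ioo (a b : ℝ) (n : ℤ) (ha : a ∈ Set.Ioo (0 : ℝ) 1) (hb : b ∈ Set.Ioc (0 : ℝ) 1)
    (h : b = a + n) : b = a := by
  have h1 : (n : ℝ) < 1 := by linarith [ha.1, hb.2]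
  have h2 : (-1 : ℝ) < n := by linarith [ha.2, hb.1]
  have h3 : n < 1 := by exact_mod_cast h1
  have h4 : -1 < n := by exact_mod_cast h2
  have : n = 0 := by omega
  simpa [this] using h

lemma coe_eq_iff' (a b : ℝ) : ((b : AddCircle (1 : ℝ)) = a) ↔ ∃ n : ℤ, b = a + n := by
  rw [← sub_eq_zero, ← AddCircle.coe_sub, AddCircle.coe_eq_zero_iff]
  refine exists_congr fun n => ?_
  simp only [zsmul_eq_mul, mul_one]
  constructor <;> intro h <;> linarith

lemma frontier_iUnion_null (m : ℕ) (I : Fin m → Set ℝ) (hI : ∀ i, (I i).OrdConnected) :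
    volume (frontier (⋃ i, I i)) = 0 := by
  have hsub : frontier (⋃ i, I i) ⊆ ⋃ i, frontier (I i) := by
    rintro y ⟨hy1, hy2⟩
    rw [closure_iUnion_of_finite] at hy1
    obtain ⟨i, hi⟩ := Set.mem_iUnion.1 hy1
    exact Set.mem_iUnion.2 ⟨i, hi, fun hc => hy2 (interior_mono (Set.subset_iUnion _ i) hc)⟩
  refine measure_mono_null hsub (measure_iUnion_null fun i => ?_)
  exact (hI i).convex.addHaar_frontier _

lemma volume_eq_haar :
    (volume : Measure (AddCircle (1 : ℝ))) = AddCircle.haarAddCircle := by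
  rw [AddCircle.volume_eq_smul_haarAddCircle]; simp

lemma image_frontier_null (J : Set ℝ) (hJ : J ⊆ Set.Ioo 0 1) (h0 : volume (frontier J) = 0) :
    (AddCircle.haarAddCircle : Measure (AddCircle (1 : ℝ)))
      (frontier (((↑) : ℝ → AddCircle (1 : ℝ)) '' J)) = 0 := by
  have hcl : closure (((↑) : ℝ → AddCircle (1 : ℝ)) '' J)
      ⊆ ((↑) : ℝ → AddCircle (1 : ℝ)) '' closure J := by
    have hb : Bornology.IsBounded J := (Metric.isBounded_Ioo 0 1).subset hJ
    have hcomp := hb.isCompact_closure.image (AddCircle.continuous_mk' (1 : ℝ))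
    exact closure_minimal (Set.image_mono subset_closure) hcomp.isClosed
  have hIntg : ((↑) : ℝ → AddCircle (1 : ℝ)) '' interior J
      ⊆ interior (((↑) : ℝ → AddCircle (1 : ℝ)) '' J) :=
    interior_maximal (Set.image_mono interior_subset)
      (QuotientAddGroup.isOpenMap_coe _ isOpen_interior)
  rw [haar_apply _ isClosed_frontier.measurableSet.nullMeasurableSet]
  have hsub : ((↑) : ℝ → AddCircle (1 : ℝ)) ⁻¹' (frontier (((↑) : ℝ → AddCircle (1 : ℝ)) '' J))
      ∩ Set.Ioc 0 1 ⊆ ⋃ n : ℤ, (fun y : ℝ => y + n) ⁻¹' frontier J := by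
    rintro y ⟨⟨hy1, hy2⟩, -⟩
    obtain ⟨z, hz, hzy⟩ := hcl hy1
    obtain ⟨n, hn⟩ := (coe_eq_iff' _ _).1 hzy
    refine Set.mem_iUnion.2 ⟨n, ?_⟩
    rw [Set.mem_preimage, ← hn]
    refine ⟨hz, fun hi => hy2 ?_⟩
    rw [← hzy]
    exact hIntg ⟨z, hi, rfl⟩
  refine measure_mono_null hsub (measure_iUnion_null fun n => ?_)
  rw [measure_preimage_add_right]
  exact h0

/-- **Weyl's equidistribution theorem (Lemma 3.1).** Let `f` be a nonconstant
integer polynomial, `ρ` irrational, and `J ⊆ (0,1)` a finite union of intervals.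
Then `H = {n : frac(ρ f(n)) ∈ J}` has an asymptotic density, equal to `μ(J)`. -/
theorem weyl_equidistribution_density (f : Polynomial ℤ) (hf : 0 < f.natDegree)
    (ρ : ℝ) (hρ : Irrational ρ) (J : Set ℝ) (hJ : J ⊆ Set.Ioo 0 1)
    (hJint : ∃ (n : ℕ) (I : Fin n → Set ℝ),
      (∀ i, (I i).OrdConnected) ∧ J = ⋃ i, I i) :
    Filter.Tendsto
      (fun N : ℕ =>
        (Nat.card ↥({n : ℕ | Int.fract (ρ * ((f.eval (n : ℤ) : ℤ) : ℝ)) ∈ J} ∩ Set.Icc 1 N) : ℝ)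
          / N)
      Filter.atTop (nhds (MeasureTheory.volume J).toReal) := by
  classical
  obtain ⟨m, I, hI, hJI⟩ := hJint
  have h0 : volume (frontier J) = 0 := hJI ▸ frontier_iUnion_null m I hI
  have hE0 := image_frontier_null J hJ h0
  set E : Set (AddCircle (1 : ℝ)) := ((↑) : ℝ → AddCircle (1 : ℝ)) '' J with hEdef
  have hEnull : NullMeasurableSet E volume := by
    rw [volume_eq_haar]
    exact nullMeasurableSet_of_null_frontier hE0
  have hEmeas : (AddCircle.haarAddCircle : Measure (AddCircle (1 : ℝ))) E = volume J := by
    rw [haar_apply E hEnull]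
    congr 1
    ext y
    constructor
    · rintro ⟨⟨z, hz, hzy⟩, hy⟩
      obtain ⟨n, hn⟩ := (coe_eq_iff' _ _).1 hzy.symm
      rwa [coe_inj_Ioo z y n (hJ hz) hy hn]
    · intro hy
      exact ⟨⟨y, hy, rfl⟩, Set.Ioo_subset_Ioc_self (hJ hy)⟩
  have hmem : ∀ t : ℝ, (t : AddCircle (1 : ℝ)) ∈ E ↔ Int.fract t ∈ J := by
    intro t
    constructor
    · rintro ⟨z, hz, hzt⟩
      obtain ⟨n, hn⟩ := (coe_eq_iff' _ _).1 hzt.symm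
      rw [hn, Int.fract_add_intCast, Int.fract_eq_self.2 ⟨(hJ hz).1.le, (hJ hz).2⟩]
      exact hz
    · intro ht
      refine ⟨_, ht, ?_⟩
      refine (coe_eq_iff' _ _).2 ⟨-⌊t⌋, ?_⟩
      push_cast
      rw [Int.fract]; ring
  let x : ℕ → AddCircle (1 : ℝ) := fun n =>
    ((ρ * ((f.eval ((n + 1 : ℕ) : ℤ) : ℤ) : ℝ) : ℝ) : AddCircle (1 : ℝ))
  have hx : ∀ k : ℤ, k ≠ 0 → Tendsto (wAvg (fun n => fourier k (x n))) atTop (nhds 0) := by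
    intro k hk
    have h1 := weyl_sum (ρ * k) (hρ.mul_intCast hk) _ f rfl hf
    refine (wAvg_shift _ (fun n => (wE_norm _).le) _ h1 1).congr fun N => ?_
    unfold wAvg
    congr 1
    refine Finset.sum_congr rfl fun n _ => ?_
    simp only [x, fourier_coe_apply, wE]
    congr 1
    push_cast
    ring
  have key := equidist x hx E hE0
  rw [hEmeas] at key
  refine key.congr fun N => ?_
  congr 2
  rw [Nat.card_coe_set_eq, ← Set.ncard_coe_finset]
  rw [← Set.ncard_image_of_injective _ Nat.succ_injective]
  congr 1
  ext n
  simp only [Set.mem_image, Finset.mem_coe, Finset.mem_filter, Finset.mem_range, Set.mem_inter_iff,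
    Set.mem_ofPred_eq, Set.mem_Icc, x, hmem]
  constructor
  · rintro ⟨l, ⟨hl, hl2⟩, rfl⟩
    exact ⟨hl2, by omega, by omega⟩
  · rintro ⟨h1, h2, h3⟩
    obtain ⟨l, rfl⟩ := Nat.exists_eq_add_of_le' h2
    exact ⟨l, ⟨by omega, h1⟩, rfl⟩
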